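/- arXiv:1302.0812 — 2 statements merged into one kernel-verified Lean document; each statement's English description precedes it below -/
import Mathlib

section
/- Let H, J, H_1, H_2, J_1, J_2 be non-null graphs such that H is the disjoint union of H_1 and H_2, and the complement of J is the disjoint union of the complements of J_1 and J_2. Let m = max(|V(H_1)|, |V(H_2)|, |V(J_1)|, |V(J_2)|) and 𝓕 = {H_1, H_2, J_1, J_2}. Then every {H,J}-free graph G admits an (𝓕, 2(m+1)^m)-partition. -/
/-- A graph `G` contains a graph `H` if some induced subgraph of `G` is isomorphic to `H`. -/
def Contains {α β : Type} (G : SimpleGraph α) (H : SimpleGraph β) : Prop :=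
  ∃ s : Set α, Nonempty ((G.induce s) ≃g H)

/-- `G` is `H`-free if `G` does not contain `H`. -/
def Free {α β : Type} (G : SimpleGraph α) (H : SimpleGraph β) : Prop := ¬ Contains G H

/-- The vertex type `γ` can be partitioned into `P` subsets each of which is a singleton
or satisfies the predicate `Ok`. -/
def HasPartition {γ : Type} (P : ℕ) (Ok : Set γ → Prop) : Prop :=
  ∃ X : Fin P → Set γ, (⋃ i, X i) = Set.univ ∧
    (Pairwise fun i j => Disjoint (X i) (X j)) ∧
    ∀ i, (∃ v, X i = {v}) ∨ Ok (X i)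

/-- A set is coverable by `n` good sets if at most `n` sets satisfying `good` cover it. -/
def Coverable {γ : Type} (good : Set γ → Prop) (n : ℕ) (S : Set γ) : Prop :=
  ∃ l : Finset (Set γ), l.card ≤ n ∧ (∀ X ∈ l, good X) ∧ S ⊆ ⋃ X ∈ l, X

/-- The graph `K` embeds as an induced subgraph of `G` with all vertices in `X`. -/
def HasCopyIn {α γ : Type} (G : SimpleGraph γ) (K : SimpleGraph α) (X : Set γ) : Prop :=
  ∃ f : K ↪g G, ∀ a, f a ∈ X

lemma Coverable.mono {γ : Type} {good : Set γ → Prop} {n k : ℕ} {S T : Set γ}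
    (h : Coverable good n T) (hnk : n ≤ k) (hST : S ⊆ T) : Coverable good k S := by
  obtain ⟨l, hl, hg, hc⟩ := h
  exact ⟨l, hl.trans hnk, hg, hST.trans hc⟩

lemma coverable_one {γ : Type} {good : Set γ → Prop} {S : Set γ} (h : good S) :
    Coverable good 1 S :=
  ⟨{S}, by simp, by simpa using h, by simp⟩

lemma Coverable.union {γ : Type} {good : Set γ → Prop} {n k : ℕ} {S T : Set γ}
    (hS : Coverable good n S) (hT : Coverable good k T) : Coverable good (n + k) (S ∪ T) := by
  classical
  obtain ⟨l, hl, hg, hc⟩ := hS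
  obtain ⟨l', hl', hg', hc'⟩ := hT
  refine ⟨l ∪ l', (Finset.card_union_le _ _).trans (by omega), ?_, ?_⟩
  · intro X hX
    rcases Finset.mem_union.1 hX with h | h
    exacts [hg X h, hg' X h]
  · rw [Finset.set_biUnion_union]
    exact Set.union_subset_union hc hc'

lemma Coverable.biUnion {ι γ : Type} {good : Set γ → Prop} {n : ℕ} (s : Finset ι)
    {S : ι → Set γ} (h : ∀ i ∈ s, Coverable good n (S i)) :
    Coverable good (s.card * n) (⋃ i ∈ s, S i) := by
  classical
  induction s using Finset.induction_on with
  | empty => exact ⟨∅, by simp, by simp, by simp⟩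
  | insert a s ha ih =>
    rw [Finset.set_biUnion_insert, Finset.card_insert_of_notMem ha]
    refine ((h a (Finset.mem_insert_self _ _)).union
      (ih fun i hi => h i (Finset.mem_insert_of_mem hi))).mono ?_ subset_rfl
    rw [Nat.add_mul]
    omega

lemma Coverable.hasPartition {γ : Type} {good Ok : Set γ → Prop} {P : ℕ}
    (hgood : ∀ X, good X → X.Subsingleton ∨ Ok X) (hOk : ∀ X Y, Y ⊆ X → Ok X → Ok Y)
    (hempty : Ok ∅) (h : Coverable good P Set.univ) : HasPartition P Ok := by
  classical
  obtain ⟨l, hl, hg, hc⟩ := h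
  have hmem : ∀ v : γ, ∃ X : l, v ∈ X.1 := fun v => by
    have := hc (Set.mem_univ v)
    simp only [Set.mem_iUnion] at this
    obtain ⟨X, hX, hv⟩ := this
    exact ⟨⟨X, hX⟩, hv⟩
  choose c hcv using hmem
  let e : l ↪ Fin P := l.equivFin.toEmbedding.trans (Fin.castLEEmb hl)
  refine ⟨fun i => {v | e (c v) = i}, ?_, ?_, ?_⟩
  · ext v
    simp
  · intro i j hij
    rw [Set.disjoint_left]
    rintro v rfl h
    exact hij h
  · intro i
    rcases Set.eq_empty_or_nonempty {v | e (c v) = i} with h | ⟨v, hv⟩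
    · exact Or.inr (hOk ∅ _ h.subset hempty)
    · have hsub : {w | e (c w) = i} ⊆ (c v).1 := by
        intro w hw
        have hwv : c w = c v := e.injective (Eq.trans hw (Eq.symm hv))
        exact hwv ▸ hcv w
      rcases hgood _ (hg _ (c v).2) with h | h
      · exact Or.inl ⟨v, (h.anti hsub).eq_singleton_of_mem hv⟩
      · exact Or.inr (hOk _ _ hsub h)

lemma contains_iff_nonempty_embedding {α β : Type} (G : SimpleGraph α) (H : SimpleGraph β) :
    Contains G H ↔ Nonempty (H ↪g G) :=
  ⟨fun ⟨s, ⟨f⟩⟩ => ⟨(SimpleGraph.Embedding.induce s).comp f.symm.toEmbedding⟩,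
    fun ⟨f⟩ => ⟨Set.range f, ⟨f.isoInduceRange.symm⟩⟩⟩

lemma contains_induce_iff {α γ : Type} (G : SimpleGraph γ) (K : SimpleGraph α) (X : Set γ) :
    Contains (G.induce X) K ↔ HasCopyIn G K X := by
  rw [contains_iff_nonempty_embedding]
  constructor
  · rintro ⟨f⟩
    exact ⟨(SimpleGraph.Embedding.induce X).comp f, fun a => (f a).2⟩
  · rintro ⟨f, hf⟩
    exact ⟨⟨⟨fun a => ⟨f a, hf a⟩, fun a b h => f.injective (congrArg Subtype.val h)⟩,
      fun {a b} => f.map_adj_iff⟩⟩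

lemma HasCopyIn.mono {α γ : Type} {G : SimpleGraph γ} {K : SimpleGraph α} {X Y : Set γ}
    (h : HasCopyIn G K X) (hXY : X ⊆ Y) : HasCopyIn G K Y :=
  h.imp fun _ hf a => hXY (hf a)

lemma hasCopyIn_compl_iff {α γ : Type} {G : SimpleGraph γ} {K : SimpleGraph α} {X : Set γ} :
    HasCopyIn Gᶜ Kᶜ X ↔ HasCopyIn G K X :=
  ⟨fun ⟨f, hf⟩ => ⟨SimpleGraph.Embedding.complEquiv.symm f, hf⟩,
    fun ⟨f, hf⟩ => ⟨SimpleGraph.Embedding.complEquiv f, hf⟩⟩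

lemma nonempty_sum_embedding {α₁ α₂ γ : Type} {G : SimpleGraph γ} {H₁ : SimpleGraph α₁}
    {H₂ : SimpleGraph α₂} (f₁ : H₁ ↪g G) (f₂ : H₂ ↪g G)
    (hne : ∀ a b, f₁ a ≠ f₂ b) (hadj : ∀ a b, ¬ G.Adj (f₁ a) (f₂ b)) :
    Nonempty ((H₁ ⊕g H₂) ↪g G) := by
  refine ⟨⟨⟨Sum.elim f₁ f₂, f₁.injective.sumElim f₂.injective hne⟩, ?_⟩⟩
  rintro (a | a) (b | b)
  · simp
  · simpa using hadj a b
  · simpa [G.adj_comm] using hadj b a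
  · simp

/-- If `X` is not coverable by few good sets, the vertices whose neighbourhood in `X` is coverable
by few good sets do not contain a copy of `H₁`, because every vertex of `X` far from such a copy
lies in an `H₂`-free set. -/
lemma good_setOf_coverable_neighborSet {α₁ α₂ γ : Type} [Fintype α₁] {G : SimpleGraph γ}
    {H₁ : SimpleGraph α₁} {H₂ : SimpleGraph α₂} {good : Set γ → Prop} {m s : ℕ} {X : Set γ}
    (hfree : ¬ Nonempty ((H₁ ⊕g H₂) ↪g G))
    (h₁ : ∀ X, ¬ HasCopyIn G H₁ X → good X) (h₂ : ∀ X, ¬ HasCopyIn G H₂ X → good X)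
    (hs : ∀ v, good {v}) (hm : Fintype.card α₁ ≤ m)
    (hX : ¬ Coverable good (m * (s + 1) + 1) X) :
    good {v | Coverable good s (X ∩ G.neighborSet v)} := by
  refine h₁ _ ?_
  rintro ⟨f, hf⟩
  let N : Set γ := ⋃ a ∈ (Finset.univ : Finset α₁), ((X ∩ G.neighborSet (f a)) ∪ {f a})
  have hN : Coverable good (m * (s + 1)) N :=
    (Coverable.biUnion Finset.univ fun a _ => (hf a).union (coverable_one (hs (f a)))).mono
      (Nat.mul_le_mul_right _ hm) subset_rfl
  have hrest : Coverable good 1 (X \ N) := by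
    refine coverable_one (h₂ _ ?_)
    rintro ⟨g, hg⟩
    refine hfree (nonempty_sum_embedding f g ?_ ?_)
    · intro a b hab
      refine (hg b).2 (Set.mem_biUnion (Finset.mem_univ a) (Or.inr hab.symm))
    · intro a b hab
      exact (hg b).2 (Set.mem_biUnion (Finset.mem_univ a) (Or.inl ⟨(hg b).1, hab⟩))
  refine hX ((hN.union hrest).mono le_rfl ?_)
  rw [Set.union_sdiff_self]
  exact Set.subset_union_right

/-- Build an induced copy of `K` one vertex at a time, keeping large candidate sets for the
remaining vertices as well as a large set `Y` complete to all chosen vertices. -/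
lemma exists_copy_complete_to_large {β γ : Type} {G : SimpleGraph γ} (K : SimpleGraph β)
    {good : Set γ → Prop} {m : ℕ} (hm : 0 < m)
    (hN : ∀ X s, ¬ Coverable good (m * (s + 1) + 1) X →
      good {v | Coverable good s (X ∩ G.neighborSet v)})
    (hN' : ∀ X s, ¬ Coverable good (m * (s + 1) + 1) X →
      good {v | Coverable good s (X ∩ Gᶜ.neighborSet v)})
    (S : Finset β) (X : β → Set γ) (Y : Set γ)
    (hX : ∀ j ∈ S, ¬ Coverable good (2 * (m + 1) ^ S.card - 1) (X j))
    (hY : ¬ Coverable good (2 * (m + 1) ^ S.card - 1) Y) :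
    ∃ g : β → γ, (∀ j ∈ S, g j ∈ X j) ∧
      (∀ i ∈ S, ∀ j ∈ S, (K.Adj i j → G.Adj (g i) (g j)) ∧
        (Kᶜ.Adj i j → Gᶜ.Adj (g i) (g j))) ∧
      ∃ Y' ⊆ Y, ¬ Coverable good 1 Y' ∧ ∀ i ∈ S, ∀ y ∈ Y', G.Adj (g i) y := by
  classical
  induction S using Finset.induction_on generalizing X Y with
  | empty =>
    have hne : Y.Nonempty := by
      by_contra h
      rw [Set.not_nonempty_iff_eq_empty] at h
      exact hY ⟨∅, by simp, by simp, by simp [h]⟩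
    exact ⟨fun _ => hne.some, by simp, by simp, Y, subset_rfl, by simpa using hY, by simp⟩
  | insert a S ha ih =>
    rw [Finset.card_insert_of_notMem ha] at hX hY
    set s := 2 * (m + 1) ^ S.card - 1 with hs
    have hpos : 0 < (m + 1) ^ S.card := by positivity
    have hstep : m * (s + 1) + 1 ≤ 2 * (m + 1) ^ (S.card + 1) - 1 := by
      have h1 : s + 1 = 2 * (m + 1) ^ S.card := by omega
      have h2 : 2 * (m + 1) ^ (S.card + 1)
          = m * (2 * (m + 1) ^ S.card) + 2 * (m + 1) ^ S.card := by ring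
      rw [h1, h2]
      omega
    have hcard : S.card + 1 ≤ 2 * (m + 1) ^ (S.card + 1) - 1 := by
      have := Nat.lt_pow_self (n := S.card + 1) (a := m + 1) (by omega)
      omega
    let R : β → γ → Set γ := fun j v =>
      if K.Adj a j then X j ∩ G.neighborSet v else X j ∩ Gᶜ.neighborSet v
    have hbad : ∀ j ∈ S, Coverable good 1 {v | Coverable good s (R j v)} := by
      intro j hj
      have hXj := fun h : Coverable good (m * (s + 1) + 1) (X j) =>
        hX j (Finset.mem_insert_of_mem hj) (h.mono hstep subset_rfl)
      by_cases h : K.Adj a j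
      · simpa only [R, if_pos h] using coverable_one (hN _ _ hXj)
      · simpa only [R, if_neg h] using coverable_one (hN' _ _ hXj)
    have hbadY : Coverable good 1 {v | Coverable good s (Y ∩ G.neighborSet v)} :=
      coverable_one (hN _ _ fun h => hY (h.mono hstep subset_rfl))
    obtain ⟨v, hvX, hv⟩ := Set.not_subset.1 fun hsub =>
      hX a (Finset.mem_insert_self a S)
        (((Coverable.biUnion S hbad).union hbadY).mono (by omega) hsub)
    simp only [Set.mem_union, Set.mem_iUnion, Set.mem_ofPred_eq, not_or, not_exists] at hv
    obtain ⟨g, hgX, hg, Y', hY'Y, hY', hgY⟩ := ih (fun j => R j v) (Y ∩ G.neighborSet v) hv.1 hv.2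
    have hne : ∀ j ∈ S, j ≠ a := fun j hj h => ha (h ▸ hj)
    have hgv : ∀ j ∈ S, g j ∈ X j ∧ (K.Adj a j → G.Adj v (g j)) ∧
        (Kᶜ.Adj a j → Gᶜ.Adj v (g j)) := by
      intro j hj
      have h := hgX j hj
      by_cases hadj : K.Adj a j
      · simp only [R, if_pos hadj] at h
        exact ⟨h.1, fun _ => h.2, fun h' => absurd hadj h'.2⟩
      · simp only [R, if_neg hadj] at h
        exact ⟨h.1, fun h' => absurd h' hadj, fun _ => h.2⟩
    refine ⟨Function.update g a v, ?_, ?_, Y', hY'Y.trans Set.inter_subset_left, hY', ?_⟩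
    · intro j hj
      rcases Finset.mem_insert.1 hj with rfl | hj
      · simpa using hvX
      · simpa [hne j hj] using (hgv j hj).1
    · intro i hi j hj
      rcases Finset.mem_insert.1 hi with hia | hiS <;> rcases Finset.mem_insert.1 hj with hja | hjS
      · subst hia hja
        exact ⟨fun h => absurd h (K.loopless.irrefl _), fun h => absurd h (Kᶜ.loopless.irrefl _)⟩
      · subst hia
        simpa only [Function.update_self, Function.update_of_ne (hne j hjS)] using (hgv j hjS).2
      · subst hja
        simpa only [Function.update_self, Function.update_of_ne (hne i hiS),
          SimpleGraph.adj_comm _ i, SimpleGraph.adj_comm _ (g i)] using (hgv i hiS).2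
      · simpa only [Function.update_of_ne (hne i hiS), Function.update_of_ne (hne j hjS)]
          using hg i hiS j hjS
    · intro i hi y hy
      rcases Finset.mem_insert.1 hi with rfl | hi
      · simpa using (hY'Y hy).2
      · simpa [hne i hi] using hgY i hi y hy

/-- Let `H` be the disjoint union of non-null graphs `H₁` and `H₂`, and let `J` be the graph
whose complement is the disjoint union of `J₁ᶜ` and `J₂ᶜ`.  Let
`m = max(|V(H₁)|,|V(H₂)|,|V(J₁)|,|V(J₂)|)` and `𝓕 = {H₁,H₂,J₁,J₂}`.  Then every
`{H,J}`-free graph admits an `(𝓕, 2(m+1)^m)`-partition. -/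
theorem stmt3 {α₁ α₂ β₁ β₂ : Type} [Fintype α₁] [Fintype α₂] [Fintype β₁] [Fintype β₂]
    [Nonempty α₁] [Nonempty α₂] [Nonempty β₁] [Nonempty β₂]
    (H₁ : SimpleGraph α₁) (H₂ : SimpleGraph α₂) (J₁ : SimpleGraph β₁) (J₂ : SimpleGraph β₂)
    (H : SimpleGraph (α₁ ⊕ α₂)) (J : SimpleGraph (β₁ ⊕ β₂))
    (hH : H = H₁ ⊕g H₂) (hJ : Jᶜ = J₁ᶜ ⊕g J₂ᶜ)
    (m : ℕ)
    (hm : m = max (max (Fintype.card α₁) (Fintype.card α₂))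
                  (max (Fintype.card β₁) (Fintype.card β₂))) :
    ∀ (γ : Type) [Fintype γ] (G : SimpleGraph γ), Free G H → Free G J →
      HasPartition (2 * (m + 1) ^ m) (fun X : Set γ =>
        Free (G.induce X) H₁ ∨ Free (G.induce X) H₂ ∨
        Free (G.induce X) J₁ ∨ Free (G.induce X) J₂) := by
  intro γ _ G hGH hGJ
  subst hH
  have hHfree : ¬ Nonempty ((H₁ ⊕g H₂) ↪g G) := fun h =>
    hGH ((contains_iff_nonempty_embedding _ _).2 h)
  have hJfree : ¬ Nonempty ((J₁ᶜ ⊕g J₂ᶜ) ↪g Gᶜ) := by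
    rintro ⟨f⟩
    rw [← hJ] at f
    exact hGJ ((contains_iff_nonempty_embedding _ _).2 ⟨SimpleGraph.Embedding.complEquiv.symm f⟩)
  simp only [Free, contains_induce_iff]
  let ok : Set γ → Prop := fun X =>
    ¬ HasCopyIn G H₁ X ∨ ¬ HasCopyIn G H₂ X ∨ ¬ HasCopyIn G J₁ X ∨ ¬ HasCopyIn G J₂ X
  let good : Set γ → Prop := fun X => X.Subsingleton ∨ ok X
  have hsingle : ∀ v, good {v} := fun v => Or.inl Set.subsingleton_singleton
  suffices h : Coverable good (2 * (m + 1) ^ m) Set.univ by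
    refine h.hasPartition (good := good) (fun X hX => hX) ?_ ?_
    · intro X Y hYX
      exact Or.imp (mt (·.mono hYX)) <| Or.imp (mt (·.mono hYX)) <|
        Or.imp (mt (·.mono hYX)) (mt (·.mono hYX))
    · exact Or.inl fun ⟨f, hf⟩ => hf (Classical.arbitrary α₁)
  have hα₁ : Fintype.card α₁ ≤ m := by omega
  have hβ₁ : Fintype.card β₁ ≤ m := by omega
  have hm0 : 0 < m := lt_of_lt_of_le Fintype.card_pos hα₁
  by_contra hcover
  have hlarge : ¬ Coverable good (2 * (m + 1) ^ (Finset.univ : Finset β₁).card - 1)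
      Set.univ := by
    refine fun h => hcover (h.mono ?_ subset_rfl)
    have := Nat.pow_le_pow_right (n := m + 1) (by omega) hβ₁
    rw [Finset.card_univ]
    omega
  obtain ⟨g, -, hg, Y, -, hY, hgY⟩ := exists_copy_complete_to_large J₁ (G := G) hm0
    (fun X s hX => good_setOf_coverable_neighborSet hHfree
      (fun X hX => Or.inr (Or.inl hX)) (fun X hX => Or.inr (Or.inr (Or.inl hX))) hsingle hα₁ hX)
    (fun X s hX => good_setOf_coverable_neighborSet hJfree
      (fun X hX => Or.inr (Or.inr (Or.inr (Or.inl (mt hasCopyIn_compl_iff.2 hX)))))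
      (fun X hX => Or.inr (Or.inr (Or.inr (Or.inr (mt hasCopyIn_compl_iff.2 hX)))))
      hsingle hβ₁ hX)
    Finset.univ (fun _ => Set.univ) Set.univ (fun _ _ => hlarge) hlarge
  have hcopy : HasCopyIn Gᶜ J₂ᶜ Y := by
    rw [hasCopyIn_compl_iff]
    by_contra h
    exact hY (coverable_one (Or.inr (Or.inr (Or.inr (Or.inr h)))))
  obtain ⟨f₂, hf₂⟩ := hcopy
  have hg' := fun i j => hg i (Finset.mem_univ i) j (Finset.mem_univ j)
  have hinj : Function.Injective g := by
    intro i j hij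
    by_contra hne
    by_cases h : J₁.Adj i j
    · exact ((hg' i j).1 h).ne hij
    · exact ((hg' i j).2 ⟨hne, h⟩).ne hij
  let f₁ : J₁ᶜ ↪g Gᶜ := ⟨⟨g, hinj⟩, fun {i j} =>
    ⟨fun h => ⟨fun hij => h.1 (congrArg g hij), fun h' => h.2 ((hg' i j).1 h')⟩, (hg' i j).2⟩⟩
  have hadj : ∀ a b, G.Adj (f₁ a) (f₂ b) := fun a b => hgY a (Finset.mem_univ a) _ (hf₂ b)
  exact hJfree (nonempty_sum_embedding f₁ f₂ (fun a b => (hadj a b).ne)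
    (fun a b h => h.2 (hadj a b)))
end

section
/- Let H and J be graphs each with at least one edge. Then for every choice of non-negative integers r and k there is a graph G such that: (i) for every S ⊆ V(G) with |S| ≤ r, the induced subgraph G|S is {H,J}-split; and (ii) G has no ({H,J}, k)-partition. -/
/-- `G` is `{H₁,H₂}`-split if `V(G) = X₁ ∪ X₂` where `G|Xᵢ` is `Hᵢ`-free for `i = 1,2`. -/
def Split {γ α β : Type} (G : SimpleGraph γ) (H₁ : SimpleGraph α) (H₂ : SimpleGraph β) : Prop :=
  ∃ X₁ X₂ : Set γ, X₁ ∪ X₂ = Set.univ ∧ Free (G.induce X₁) H₁ ∧ Free (G.induce X₂) H₂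


/-- In the family of hyperedges `φ e : ι → V`, the hyperedge `e` shares at most one vertex
with the union of the other hyperedges in `A`. -/
def IsLeafEdge {ι V E : Type} (φ : E → ι → V) (A : Finset E) (e : E) : Prop :=
  {i | ∃ e' ∈ A, e' ≠ e ∧ ∃ j, φ e' j = φ e i}.Subsingleton

/-- Every set of at least two and at most `g` hyperedges has two distinct leaves. For injective
hyperedges this says that there is no Berge cycle of length at most `g`. -/
def LocallyForest {ι V E : Type} (φ : E → ι → V) (g : ℕ) : Prop :=
  ∀ A : Finset E, 1 < A.card → A.card ≤ g →
    ∃ e₁ ∈ A, ∃ e₂ ∈ A, e₁ ≠ e₂ ∧ IsLeafEdge φ A e₁ ∧ IsLeafEdge φ A e₂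

/-- Every colouring of the vertices by `K` has a monochromatic hyperedge. -/
def VertexRamsey {ι V E : Type} (φ : E → ι → V) (K : Type) : Prop :=
  ∀ col : V → K, ∃ e κ, ∀ i, col (φ e i) = κ

/-- A leaf can be chosen so that a prescribed set of at most one vertex adds no further
contact. -/
lemma LocallyForest.exists_leaf_rooted {ι V E : Type} {φ : E → ι → V} {g : ℕ}
    (h : LocallyForest φ g) (hφ : ∀ e, (φ e).Injective) {A : Finset E} (hA : A.Nonempty)
    (hg : A.card ≤ g) {R : Set V} (hR : R.Subsingleton) :
    ∃ e ∈ A, {i | φ e i ∈ R ∨ ∃ e' ∈ A, e' ≠ e ∧ ∃ j, φ e' j = φ e i}.Subsingleton := by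
  rcases Nat.lt_or_ge 1 A.card with h1 | h1
  · obtain ⟨e₁, he₁, e₂, he₂, hne, hl₁, hl₂⟩ := h A h1 hg
    by_cases hc : ∀ i, φ e₁ i ∈ R → ∃ e' ∈ A, e' ≠ e₁ ∧ ∃ j, φ e' j = φ e₁ i
    · refine ⟨e₁, he₁, hl₁.anti ?_⟩
      rintro i (hi | hi)
      · exact hc i hi
      · exact hi
    · push Not at hc
      obtain ⟨i₀, hi₀, hn⟩ := hc
      refine ⟨e₂, he₂, hl₂.anti ?_⟩
      rintro i (hi | hi)
      · exact absurd (hR hi hi₀) (hn e₂ he₂ hne.symm i)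
      · exact hi
  · obtain ⟨e, rfl⟩ := Finset.card_eq_one.1 (le_antisymm h1 hA.card_pos)
    refine ⟨e, by simp, ?_⟩
    rintro i hi j hj
    simp only [Finset.mem_singleton, Set.mem_ofPred_eq] at hi hj
    have hi' : φ e i ∈ R := by
      rcases hi with hi | ⟨e', rfl, hne, _⟩
      · exact hi
      · exact absurd rfl hne
    have hj' : φ e j ∈ R := by
      rcases hj with hj | ⟨e', rfl, hne, _⟩
      · exact hj
      · exact absurd rfl hne
    exact hφ e (hR hi' hj')

/-- Amalgamate copies of `φ`, one for each hyperedge `t` of `τ`, identifying the class `c` of the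
copy indexed by `t` with the vertices of `t`. -/
noncomputable def amalgam {ι V E C Y T : Type} (φ : E → ι → V) (p : V → C) (c : C)
    (τ : T → {v // p v = c} → Y) (te : T × E) (i : ι) : Y ⊕ (T × V) :=
  open Classical in
  if h : p (φ te.2 i) = c then Sum.inl (τ te.1 ⟨φ te.2 i, h⟩) else Sum.inr (te.1, φ te.2 i)

section Amalgam

variable {ι V E C Y T : Type} {φ : E → ι → V} {p : V → C} {c : C}
  {τ : T → {v // p v = c} → Y}

lemma amalgam_of_eq {t : T} {e : E} {i : ι} (h : p (φ e i) = c) :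
    amalgam φ p c τ (t, e) i = Sum.inl (τ t ⟨φ e i, h⟩) := dif_pos h

lemma amalgam_of_ne {t : T} {e : E} {i : ι} (h : p (φ e i) ≠ c) :
    amalgam φ p c τ (t, e) i = Sum.inr (t, φ e i) := dif_neg h

lemma class_amalgam (t : T) (e : E) (i : ι) :
    Sum.elim (fun _ => c) (fun x => p x.2) (amalgam φ p c τ (t, e) i) = p (φ e i) := by
  by_cases h : p (φ e i) = c
  · rw [amalgam_of_eq h, Sum.elim_inl, h]
  · rw [amalgam_of_ne h, Sum.elim_inr]

/-- Two vertices of the same copy are identified only if they are equal. -/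
lemma eq_of_amalgam_eq (hτ : ∀ t, (τ t).Injective) {t : T} {e e' : E} {i j : ι}
    (h : amalgam φ p c τ (t, e') j = amalgam φ p c τ (t, e) i) : φ e' j = φ e i := by
  have hp := congrArg (Sum.elim (fun _ => c) (fun x => p x.2)) h
  rw [class_amalgam, class_amalgam] at hp
  by_cases hc : p (φ e i) = c
  · rw [amalgam_of_eq hc, amalgam_of_eq (hp.trans hc)] at h
    exact congrArg Subtype.val (hτ t (Sum.inl_injective h))
  · rw [amalgam_of_ne hc, amalgam_of_ne (hp ▸ hc)] at h
    exact congrArg Prod.snd (Sum.inr_injective h)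

/-- Vertices of distinct copies are identified only inside the class `c`. -/
lemma exists_of_amalgam_eq {t t' : T} (ht : t' ≠ t) {e e' : E} {i j : ι}
    (h : amalgam φ p c τ (t', e') j = amalgam φ p c τ (t, e) i) :
    ∃ hc : p (φ e i) = c, ∃ x, τ t' x = τ t ⟨φ e i, hc⟩ := by
  have hp := congrArg (Sum.elim (fun _ => c) (fun x => p x.2)) h
  rw [class_amalgam, class_amalgam] at hp
  by_cases hc : p (φ e i) = c
  · rw [amalgam_of_eq hc, amalgam_of_eq (hp.trans hc)] at h
    exact ⟨hc, _, Sum.inl_injective h⟩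
  · rw [amalgam_of_ne hc, amalgam_of_ne (hp ▸ hc)] at h
    exact absurd (congrArg Prod.fst (Sum.inr_injective h)) ht

/-- Amalgamating along a system without short cycles increases the length of short cycles:
a cycle through several copies uses at least two hyperedges in some copy. -/
lemma LocallyForest.amalgam {g : ℕ} (hφ : LocallyForest φ (g + 1))
    (hinj : ∀ e, (p ∘ φ e).Injective) (hτ : LocallyForest τ g)
    (hτinj : ∀ t, (τ t).Injective) : LocallyForest (amalgam φ p c τ) (g + 1) := by
  classical
  intro A hA1 hAg
  have hφinj : ∀ e, (φ e).Injective := fun e => (hinj e).of_comp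
  have key : ∀ t ∈ A.image Prod.fst, IsLeafEdge τ (A.image Prod.fst) t →
      ∃ e, (t, e) ∈ A ∧ IsLeafEdge (_root_.amalgam φ p c τ) A (t, e) := by
    intro t ht hleaf
    have hmem : ∀ e, e ∈ (A.filter fun x => x.1 = t).image Prod.snd ↔ (t, e) ∈ A := by
      intro e
      simp
    obtain ⟨⟨t₀, e₀⟩, he₀, rfl⟩ := Finset.mem_image.1 ht
    obtain ⟨e, he, hs⟩ := hφ.exists_leaf_rooted hφinj ⟨e₀, (hmem e₀).2 he₀⟩
      ((Finset.card_image_le.trans (Finset.card_filter_le _ _)).trans hAg)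
      (R := {v | ∃ h : p v = c, (⟨v, h⟩ : {v // p v = c}) ∈
        {i | ∃ t' ∈ A.image Prod.fst, t' ≠ t₀ ∧ ∃ j, τ t' j = τ t₀ i}})
      (by
        rintro v ⟨hv, hv'⟩ w ⟨hw, hw'⟩
        exact congrArg Subtype.val (hleaf hv' hw'))
    refine ⟨e, (hmem e).1 he, hs.anti ?_⟩
    rintro i ⟨⟨t', e'⟩, hA', hne, j, hj⟩
    by_cases htt : t' = t₀
    · subst htt
      exact Or.inr ⟨e', (hmem e').2 hA', fun h => hne (by rw [h]), j,
        eq_of_amalgam_eq hτinj hj⟩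
    · obtain ⟨hc, x, hx⟩ := exists_of_amalgam_eq htt hj
      exact Or.inl ⟨hc, t', Finset.mem_image_of_mem Prod.fst hA', htt, x, hx⟩
  have hpos : 0 < (A.image Prod.fst).card :=
    ((Finset.card_pos.1 (by omega : 0 < A.card)).image _).card_pos
  rcases Nat.lt_or_ge 1 (A.image Prod.fst).card with h1 | h1
  · rcases Nat.lt_or_ge g (A.image Prod.fst).card with h2 | h2
    · have hfst : Set.InjOn Prod.fst (A : Set (T × E)) :=
        Finset.card_image_iff.1 (le_antisymm Finset.card_image_le (by omega))
      have hall : ∀ x ∈ A, IsLeafEdge (_root_.amalgam φ p c τ) A x := by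
        rintro ⟨t, e⟩ hx
        have hc : ∀ i, (∃ e' ∈ A, e' ≠ (t, e) ∧
            ∃ j, _root_.amalgam φ p c τ e' j = _root_.amalgam φ p c τ (t, e) i) →
            p (φ e i) = c := by
          rintro i ⟨⟨t', e'⟩, hx', hne, j, hj⟩
          exact (exists_of_amalgam_eq (fun h => hne (hfst hx' hx h)) hj).1
        intro i hi j hj
        exact hinj e ((hc i hi).trans (hc j hj).symm)
      obtain ⟨x, hx, y, hy, hxy⟩ := Finset.one_lt_card.1 hA1
      exact ⟨x, hx, y, hy, hxy, hall x hx, hall y hy⟩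
    · obtain ⟨t₁, ht₁, t₂, ht₂, hne, hl₁, hl₂⟩ := hτ _ h1 h2
      obtain ⟨e₁, he₁, hle₁⟩ := key t₁ ht₁ hl₁
      obtain ⟨e₂, he₂, hle₂⟩ := key t₂ ht₂ hl₂
      exact ⟨_, he₁, _, he₂, fun h => hne (congrArg Prod.fst h), hle₁, hle₂⟩
  · obtain ⟨t, ht⟩ := Finset.card_eq_one.1 (le_antisymm h1 hpos)
    have hfst : ∀ x ∈ A, x.1 = t := fun x hx =>
      Finset.mem_singleton.1 (ht ▸ Finset.mem_image_of_mem Prod.fst hx)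
    have hsnd : Set.InjOn Prod.snd (A : Set (T × E)) := fun x hx y hy h =>
      Prod.ext ((hfst x hx).trans (hfst y hy).symm) h
    have hmem : ∀ e, e ∈ A.image Prod.snd → (t, e) ∈ A := by
      intro e he
      obtain ⟨⟨t', e'⟩, hx, rfl⟩ := Finset.mem_image.1 he
      exact hfst _ hx ▸ hx
    have hleaf : ∀ e, IsLeafEdge φ (A.image Prod.snd) e →
        IsLeafEdge (_root_.amalgam φ p c τ) A (t, e) := by
      intro e he
      refine he.anti ?_
      rintro i ⟨⟨t', e'⟩, hx, hne, j, hj⟩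
      obtain rfl : t' = t := hfst _ hx
      exact ⟨e', Finset.mem_image_of_mem Prod.snd hx, fun h => hne (by rw [h]), j,
        eq_of_amalgam_eq hτinj hj⟩
    have hcard := Finset.card_image_iff.2 hsnd
    obtain ⟨e₁, he₁, e₂, he₂, hne, hl₁, hl₂⟩ :=
      hφ (A.image Prod.snd) (by omega) (by omega)
    exact ⟨_, hmem _ he₁, _, hmem _ he₂, fun h => hne (congrArg Prod.snd h),
      hleaf _ hl₁, hleaf _ hl₂⟩

end Amalgam

/-- If `C` is large then every `K`-colouring of `C` is constant on the image of some
embedding of `ι`. -/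
lemma exists_large_vertexRamsey (ι K : Type) [Finite ι] [Finite K] [Nonempty K] :
    ∃ (C : Type) (_ : Finite C), VertexRamsey (fun (u : ι ↪ C) (i : ι) => u i) K := by
  classical
  have := Fintype.ofFinite ι
  have := Fintype.ofFinite K
  refine ⟨Fin (Fintype.card K * Fintype.card ι), inferInstance, fun col => ?_⟩
  obtain ⟨κ, hκ⟩ := Fintype.exists_le_card_fiber_of_mul_le_card (n := Fintype.card ι) col
    (by simp)
  rw [← Fintype.card_coe] at hκ
  obtain ⟨u⟩ := Function.Embedding.nonempty_of_card_le hκ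
  exact ⟨u.trans (Function.Embedding.subtype _), κ, fun i => (Finset.mem_filter.1 (u i).2).2⟩

/-- Given systems without cycles of length at most `g`, there is a `C`-partite system without
cycles of length at most `g + 1` in which every colouring is, on some hyperedge of each
type `u`, determined by the class for all classes in `D`. -/
lemma exists_partite_system {g : ℕ} {ι C K : Type} [Finite ι] [Finite C] [Nonempty K]
    (ih : ∀ (ι' : Type) [Finite ι'], ∃ (Y T : Type) (_ : Finite Y) (_ : Finite T)
      (τ : T → ι' → Y), (∀ t, (τ t).Injective) ∧ LocallyForest τ g ∧ VertexRamsey τ K)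
    (D : Finset C) :
    ∃ (V E : Type) (_ : Finite V) (_ : Finite E) (φ : E → ι → V) (p : V → C),
      (∀ e, (p ∘ φ e).Injective) ∧ LocallyForest φ (g + 1) ∧
      ∀ col : V → K, ∃ κ : C → K, ∀ u : ι ↪ C, ∃ e, p ∘ φ e = u ∧
        ∀ i, u i ∈ D → col (φ e i) = κ (u i) := by
  classical
  induction D using Finset.induction_on with
  | empty =>
    refine ⟨(ι ↪ C) × ι, ι ↪ C, inferInstance, inferInstance, Prod.mk, fun x => x.1 x.2,
      fun e => e.injective, ?_, ?_⟩
    · have hall : ∀ (A : Finset (ι ↪ C)) e,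
          IsLeafEdge (Prod.mk : (ι ↪ C) → ι → (ι ↪ C) × ι) A e := by
        rintro A e i ⟨e', _, hne, j, hj⟩
        exact absurd (congrArg Prod.fst hj) hne
      intro A hA _
      obtain ⟨x, hx, y, hy, hxy⟩ := Finset.one_lt_card.1 hA
      exact ⟨x, hx, y, hy, hxy, hall A x, hall A y⟩
    · exact fun _ => ⟨fun _ => Classical.arbitrary K, fun u => ⟨u, rfl, by simp⟩⟩
  | insert c D hc hD =>
    obtain ⟨V, E, _, _, φ, p, hinj, hφ, hcol⟩ := hD
    obtain ⟨Y, T, _, _, τ, hτinj, hτ, hram⟩ := ih {v // p v = c}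
    refine ⟨Y ⊕ (T × V), T × E, inferInstance, inferInstance, amalgam φ p c τ,
      Sum.elim (fun _ => c) (fun x => p x.2), ?_, hφ.amalgam hinj hτ hτinj, ?_⟩
    · rintro ⟨t, e⟩ i j hij
      simp only [Function.comp_apply, class_amalgam] at hij
      exact hinj e hij
    · intro col
      obtain ⟨t, κ₀, ht⟩ := hram (col ∘ Sum.inl)
      obtain ⟨κ, hκ⟩ := hcol fun v => col (Sum.inr (t, v))
      refine ⟨Function.update κ c κ₀, fun u => ?_⟩
      obtain ⟨e, he, hD⟩ := hκ u
      have hpe : ∀ i, p (φ e i) = u i := congrFun he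
      refine ⟨(t, e), funext fun i => (class_amalgam t e i).trans (hpe i), fun i hi => ?_⟩
      by_cases hic : u i = c
      · rw [amalgam_of_eq ((hpe i).trans hic)]
        exact (ht _).trans (by rw [hic, Function.update_self])
      · rw [amalgam_of_ne (hpe i ▸ hic), Function.update_of_ne hic]
        exact hD i (Finset.mem_of_mem_insert_of_ne hi hic)

/-- There are finite uniform hypergraphs of large girth and large chromatic number. -/
theorem exists_locallyForest_vertexRamsey (K : Type) [Finite K] [Nonempty K] (g : ℕ) :
    ∀ (ι : Type) [Finite ι], ∃ (V E : Type) (_ : Finite V) (_ : Finite E) (φ : E → ι → V),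
      (∀ e, (φ e).Injective) ∧ LocallyForest φ g ∧ VertexRamsey φ K := by
  induction g with
  | zero =>
    intro ι _
    obtain ⟨C, _, hC⟩ := exists_large_vertexRamsey ι K
    exact ⟨C, ι ↪ C, inferInstance, inferInstance, _, fun e => e.injective,
      fun A h1 h0 => by omega, hC⟩
  | succ g ih =>
    intro ι _
    obtain ⟨C, _, hC⟩ := exists_large_vertexRamsey ι K
    have := Fintype.ofFinite C
    obtain ⟨V, E, hV, hE, φ, p, hinj, hφ, hcol⟩ :=
      exists_partite_system (ι := ι) ih (Finset.univ : Finset C)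
    refine ⟨V, E, hV, hE, φ, fun e => (hinj e).of_comp, hφ, fun col => ?_⟩
    obtain ⟨κ, hκ⟩ := hcol col
    obtain ⟨u, κ₀, hu⟩ := hC κ
    obtain ⟨e, -, he⟩ := hκ u
    exact ⟨e, κ₀, fun i => (he i (Finset.mem_univ _)).trans (hu i)⟩

/-- Distinct hyperedges share at most one vertex. -/
lemma LocallyForest.eq_of_shared {ι V E : Type} {φ : E → ι → V} {g : ℕ}
    (h : LocallyForest φ g) (hg : 2 ≤ g) {e e' : E} (hne : e' ≠ e) {i j i' j' : ι}
    (hi : φ e' i' = φ e i) (hj : φ e' j' = φ e j) : i = j := by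
  classical
  obtain ⟨e₁, he₁, e₂, he₂, h12, hl₁, hl₂⟩ := h {e, e'} (by rw [Finset.card_pair hne.symm]; omega)
    (by rw [Finset.card_pair hne.symm]; omega)
  have hl : IsLeafEdge φ {e, e'} e := by
    simp only [Finset.mem_insert, Finset.mem_singleton] at he₁ he₂
    rcases he₁ with rfl | rfl
    · exact hl₁
    · rcases he₂ with rfl | rfl
      · exact hl₂
      · exact absurd rfl h12
  exact hl ⟨e', by simp, hne, i', hi⟩ ⟨e', by simp, hne, j', hj⟩

/-- A proper colouring of `F` extends to all copies of `F` along a small set of hyperedges. -/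
lemma LocallyForest.exists_coloring {ι V E : Type} {φ : E → ι → V} {g : ℕ}
    (h : LocallyForest φ g) (hφ : ∀ e, (φ e).Injective) {F : SimpleGraph ι} {C : Type}
    [Nonempty C] (f : F.Coloring C) (A : Finset E) (hA : A.card ≤ g) :
    ∃ col : V → C, ∀ e ∈ A, ∀ i j, F.Adj i j → col (φ e i) ≠ col (φ e j) := by
  classical
  induction hn : A.card generalizing A with
  | zero =>
    rw [Finset.card_eq_zero] at hn
    exact ⟨fun _ => Classical.arbitrary C, by simp [hn]⟩
  | succ n ih =>
    obtain ⟨e, he, hs⟩ := h.exists_leaf_rooted hφ (Finset.card_pos.1 (by omega)) hA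
      (Set.subsingleton_empty)
    simp only [Set.mem_empty_iff_false, false_or] at hs
    have hcard := Finset.card_erase_of_mem he
    obtain ⟨col, hcol⟩ := ih (A.erase e) (by omega) (by omega)
    obtain ⟨σ, hσ⟩ : ∃ σ : Equiv.Perm C,
        ∀ i, (∃ e' ∈ A, e' ≠ e ∧ ∃ j, φ e' j = φ e i) → σ (f i) = col (φ e i) := by
      rcases hs.eq_empty_or_singleton with h0 | ⟨i₀, h0⟩
      · exact ⟨1, fun i hi => absurd (h0 ▸ hi : i ∈ (∅ : Set ι)) (by simp)⟩
      · refine ⟨Equiv.swap (f i₀) (col (φ e i₀)), fun i hi => ?_⟩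
        obtain rfl : i = i₀ := (h0 ▸ hi : i ∈ ({i₀} : Set ι))
        exact Equiv.swap_apply_left _ _
    let col' : V → C := fun x => if hx : ∃ i, φ e i = x then σ (f hx.choose) else col x
    have hcol'e : ∀ i, col' (φ e i) = σ (f i) := by
      intro i
      have hx : ∃ i', φ e i' = φ e i := ⟨i, rfl⟩
      simp only [col', dif_pos hx, hφ e hx.choose_spec]
    have hcol' : ∀ e' ∈ A, e' ≠ e → ∀ j, col' (φ e' j) = col (φ e' j) := by
      intro e' he' hne j
      by_cases hx : ∃ i, φ e i = φ e' j
      · obtain ⟨i, hi⟩ := hx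
        rw [← hi, hcol'e, hσ i ⟨e', he', hne, j, hi.symm⟩]
      · simp only [col', dif_neg hx]
    refine ⟨col', fun e' he' i j hij => ?_⟩
    by_cases hee : e' = e
    · subst hee
      rw [hcol'e, hcol'e]
      exact σ.injective.ne (f.valid hij)
    · rw [hcol' e' he' hee, hcol' e' he' hee]
      exact hcol e' (Finset.mem_erase.2 ⟨hee, he'⟩) i j hij

/-- The graph obtained by placing a copy of `F` on every hyperedge. -/
def placeCopies {ι V E : Type} (φ : E → ι → V) (hφ : ∀ e, (φ e).Injective)
    (F : SimpleGraph ι) : SimpleGraph V where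
  Adj x y := ∃ e i j, F.Adj i j ∧ φ e i = x ∧ φ e j = y
  symm := ⟨fun _ _ ⟨e, i, j, h, hi, hj⟩ => ⟨e, j, i, h.symm, hj, hi⟩⟩
  loopless := ⟨fun _ ⟨e, _, _, h, hi, hj⟩ => h.ne (hφ e (hi.trans hj.symm))⟩

lemma placeCopies_adj_iff {ι V E : Type} {φ : E → ι → V} {g : ℕ} (h : LocallyForest φ g)
    (hg : 2 ≤ g) (hφ : ∀ e, (φ e).Injective) (F : SimpleGraph ι) (e : E) (i j : ι) :
    (placeCopies φ hφ F).Adj (φ e i) (φ e j) ↔ F.Adj i j := by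
  refine ⟨?_, fun hij => ⟨e, i, j, hij, rfl, rfl⟩⟩
  rintro ⟨e', i', j', hij, hi, hj⟩
  by_cases hee : e' = e
  · subst hee
    rwa [← hφ _ hi, ← hφ _ hj]
  · obtain rfl := h.eq_of_shared hg hee hi hj
    exact absurd (hφ e' (hi.trans hj.symm)) hij.ne

/-- Small induced subgraphs of `placeCopies φ hφ F` are colourable with the colours of `F`. -/
lemma placeCopies_induce_coloring {ι V E : Type} [Finite V] [Finite E] {φ : E → ι → V}
    {g r : ℕ} (h : LocallyForest φ g) (hg : 2 ≤ g) (hr : r * r ≤ g)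
    (hφ : ∀ e, (φ e).Injective) {F : SimpleGraph ι} {C : Type} [Nonempty C]
    (f : F.Coloring C) (S : Set V) (hS : S.ncard ≤ r) :
    Nonempty (((placeCopies φ hφ F).induce S).Coloring C) := by
  classical
  have := Fintype.ofFinite E
  let A : Finset E :=
    Finset.univ.filter fun e => ∃ i j, F.Adj i j ∧ φ e i ∈ S ∧ φ e j ∈ S
  have hmem : ∀ e, e ∈ A ↔ ∃ i j, F.Adj i j ∧ φ e i ∈ S ∧ φ e j ∈ S := by
    intro e
    simp [A]
  have hcard : A.card ≤ g := by
    choose a b hab ha hb using fun e : A => (hmem e).1 e.2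
    have hinj : Function.Injective
        fun e : A => ((⟨φ e (a e), ha e⟩, ⟨φ e (b e), hb e⟩) : S × S) := by
      intro e e' hee
      simp only [Prod.mk.injEq, Subtype.mk.injEq] at hee
      by_contra hne
      exact (hab e').ne (h.eq_of_shared hg (fun hh => hne (Subtype.ext hh)) hee.1 hee.2)
    have h1 := Nat.card_le_card_of_injective _ hinj
    rw [Nat.card_prod, Nat.card_eq_fintype_card, Fintype.card_coe, Nat.card_coe_set_eq] at h1
    exact h1.trans ((Nat.mul_le_mul hS hS).trans hr)
  obtain ⟨col, hcol⟩ := h.exists_coloring hφ f A hcard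
  refine ⟨SimpleGraph.Coloring.mk (fun x => col x) ?_⟩
  rintro ⟨x, hx⟩ ⟨y, hy⟩ ⟨e, i, j, hij, hi, hj⟩
  simp only [Function.Embedding.subtype_apply] at hi hj
  subst hi hj
  exact hcol e ((hmem e).2 ⟨i, j, hij, hx, hy⟩) i j hij

lemma contains_of_embedding {α β : Type} {G : SimpleGraph α} {H : SimpleGraph β}
    (f : H ↪g G) : Contains G H := by
  refine ⟨Set.range f, ⟨RelIso.symm ⟨Equiv.ofInjective f f.injective, ?_⟩⟩⟩
  intro a b
  exact f.map_adj_iff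

/-- A graph coloured by `n + 1` colours splits into a stable set and an `n`-colourable graph. -/
lemma split_of_coloring {γ α β : Type} {G : SimpleGraph γ} {H : SimpleGraph α}
    {J : SimpleGraph β} {n : ℕ} (col : G.Coloring (Fin (n + 1))) (hH : ¬ H.Colorable n)
    (hJ : ∃ u v, J.Adj u v) : Split G H J := by
  refine ⟨{x | col x ≠ 0}, {x | col x = 0}, ?_, ?_, ?_⟩
  · ext x
    simpa using em' (col x = 0)
  · rintro ⟨s, ⟨f⟩⟩
    refine hH ⟨SimpleGraph.Coloring.mk
      (fun v => (col (f.symm v).1.1).pred (f.symm v).1.2) ?_⟩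
    intro v w hvw hc
    exact col.valid (f.symm.map_adj_iff.2 hvw) (Fin.pred_inj.1 hc)
  · rintro ⟨s, ⟨f⟩⟩
    obtain ⟨u, v, huv⟩ := hJ
    exact col.valid (f.symm.map_adj_iff.2 huv) ((f.symm u).1.2.trans (f.symm v).1.2.symm)

lemma Split.symm {γ α β : Type} {G : SimpleGraph γ} {H : SimpleGraph α} {J : SimpleGraph β}
    (h : Split G H J) : Split G J H := by
  obtain ⟨X, Y, hXY, hX, hY⟩ := h
  exact ⟨Y, X, Set.union_comm X Y ▸ hXY, hY, hX⟩

/-- For some `n` the disjoint union of `H` and `J` is `(n + 1)`-colourable, while one of them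
is not `n`-colourable. -/
lemma exists_coloring_sum {α β : Type} [Finite α] [Finite β] [Nonempty α]
    (H : SimpleGraph α) (J : SimpleGraph β) :
    ∃ n, (H ⊕g J).Colorable (n + 1) ∧ (¬ H.Colorable n ∨ ¬ J.Colorable n) := by
  classical
  have := Fintype.ofFinite α
  have := Fintype.ofFinite β
  have hex : ∃ n, (H ⊕g J).Colorable n := ⟨_, (H ⊕g J).colorable_of_fintype⟩
  have hpos : Nat.find hex ≠ 0 := by
    intro h0
    have h := Nat.find_spec hex
    rw [h0] at h
    obtain ⟨col⟩ := h
    exact (col (Sum.inl (Classical.arbitrary α))).elim0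
  obtain ⟨n, hn⟩ := Nat.exists_eq_succ_of_ne_zero hpos
  have hspec := Nat.find_spec hex
  rw [hn] at hspec
  refine ⟨n, hspec, ?_⟩
  by_contra! hc
  obtain ⟨⟨a⟩, ⟨b⟩⟩ := hc
  refine Nat.find_min hex (m := n) (by omega) ⟨SimpleGraph.Coloring.mk (Sum.elim a b) ?_⟩
  rintro (v | v) (w | w) hvw
  · exact a.valid hvw
  · exact absurd hvw Bool.false_ne_true
  · exact absurd hvw Bool.false_ne_true
  · exact b.valid hvw

/-- Let `H` and `J` be graphs each with at least one edge. Then for every choice of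
non-negative integers `r` and `k` there is a graph `G` such that every induced subgraph
of `G` on at most `r` vertices is `{H,J}`-split, but `G` has no `({H,J},k)`-partition. -/
theorem stmt7 {α β : Type} [Fintype α] [Fintype β]
    (H : SimpleGraph α) (J : SimpleGraph β)
    (hH : ∃ u v, H.Adj u v) (hJ : ∃ u v, J.Adj u v) (r k : ℕ) :
    ∃ (γ : Type) (_ : Fintype γ) (G : SimpleGraph γ),
      (∀ S : Set γ, S.ncard ≤ r → Split (G.induce S) H J) ∧
      ¬ HasPartition k (fun X : Set γ => Free (G.induce X) H ∨ Free (G.induce X) J) := by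
  obtain ⟨a, b, hab⟩ := hH
  have : Nonempty α := ⟨a⟩
  obtain ⟨n, ⟨f⟩, hn⟩ := exists_coloring_sum H J
  obtain ⟨V, E, _, _, φ, hφ, hforest, hram⟩ :=
    exists_locallyForest_vertexRamsey (Fin (k + 1)) (r * r + 2) (α ⊕ β)
  have hadj := placeCopies_adj_iff hforest (by omega) hφ (H ⊕g J)
  refine ⟨V, Fintype.ofFinite V, placeCopies φ hφ (H ⊕g J), ?_, ?_⟩
  · intro S hS
    obtain ⟨col⟩ := placeCopies_induce_coloring hforest (by omega) (by omega) hφ f S hS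
    rcases hn with hn | hn
    · exact split_of_coloring col hn hJ
    · exact (split_of_coloring col hn ⟨a, b, hab⟩).symm
  · rintro ⟨X, hX, -, hOk⟩
    have hcov : ∀ v, ∃ i, v ∈ X i := fun v => Set.mem_iUnion.1 (hX ▸ Set.mem_univ v)
    choose part hpart using hcov
    obtain ⟨e, κ, he⟩ := hram fun v => (part v).castSucc
    have hsub : ∀ x, φ e x ∈ X (part (φ e (Sum.inl a))) := by
      intro x
      rw [← Fin.castSucc_injective k ((he x).trans (he (Sum.inl a)).symm)]
      exact hpart _
    rcases hOk (part (φ e (Sum.inl a))) with ⟨v, hv⟩ | hfree | hfree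
    · have ha := hsub (Sum.inl a)
      have hb := hsub (Sum.inl b)
      rw [hv, Set.mem_singleton_iff] at ha hb
      exact hab.ne (Sum.inl_injective (hφ e (ha.trans hb.symm)))
    · refine hfree (contains_of_embedding
        ⟨⟨fun x => ⟨φ e (Sum.inl x), hsub _⟩, fun x y hxy => ?_⟩, fun {x y} => ?_⟩)
      · exact Sum.inl_injective (hφ e (congrArg Subtype.val hxy))
      · exact hadj e (Sum.inl x) (Sum.inl y)
    · refine hfree (contains_of_embedding
        ⟨⟨fun x => ⟨φ e (Sum.inr x), hsub _⟩, fun x y hxy => ?_⟩, fun {x y} => ?_⟩)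
      · exact Sum.inr_injective (hφ e (congrArg Subtype.val hxy))
      · exact hadj e (Sum.inr x) (Sum.inr y)
end
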